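/- arXiv:0706.2044 — 7 statements merged into one kernel-verified Lean document; each statement's English description precedes it below -/
import Mathlib

section
/- For every c ≥ 1 there exists a constant C > 0, depending only on c, such that for all real numbers s₁, s₂ and all ℓ₁, ℓ₂ > 0 with (s₁ − s₂)²·ℓ₁·ℓ₂ ≤ c, the points z₁ = s₁ + i/ℓ₁ and z₂ = s₂ + i/ℓ₂ of the hyperbolic upper half-plane satisfy |dist_ℍ(z₁, z₂) − |log(ℓ₁/ℓ₂)|| ≤ C. -/
open Real

/-- The hyperbolic cosine of the distance, with the horizontal and vertical displacements
separated. -/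
theorem UpperHalfPlane.cosh_dist_eq_add_cosh_log (z w : UpperHalfPlane) :
    cosh (dist z w) = (z.re - w.re) ^ 2 / (2 * z.im * w.im) + cosh (log (z.im / w.im)) := by
  have hz := z.im_pos
  have hw := w.im_pos
  rw [UpperHalfPlane.cosh_dist', cosh_log (div_pos hz hw)]
  field_simp
  ring

theorem UpperHalfPlane.dist_le_abs_log_add {c : ℝ} (hc : 0 ≤ c) (z w : UpperHalfPlane)
    (h : (z.re - w.re) ^ 2 / (z.im * w.im) ≤ c) :
    dist z w ≤ |log (z.im / w.im)| + log (c + 2) := by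
  set L := log (z.im / w.im) with hL
  have hcosh : cosh (dist z w) ≤ c / 2 + cosh |L| := by
    rw [UpperHalfPlane.cosh_dist_eq_add_cosh_log, ← hL, cosh_abs, mul_assoc, mul_comm 2, ← div_div]
    linarith
  have hd : exp (dist z w) ≤ 2 * cosh (dist z w) := by
    rw [cosh_eq]
    linarith [exp_pos (-dist z w)]
  have hone : 1 ≤ exp |L| := one_le_exp (abs_nonneg L)
  have hexp : cosh |L| ≤ exp |L| := by
    rw [cosh_eq]
    linarith [exp_le_exp.2 (neg_le_self (abs_nonneg L))]
  rw [← exp_le_exp, exp_add, exp_log (by linarith)]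
  nlinarith

theorem H2_distance_bounded_twist (c : ℝ) (hc : 1 ≤ c) :
    ∃ C > 0, ∀ (s₁ s₂ ℓ₁ ℓ₂ : ℝ), 0 < ℓ₁ → 0 < ℓ₂ →
      (s₁ - s₂) ^ 2 * ℓ₁ * ℓ₂ ≤ c →
      ∀ (z₁ z₂ : UpperHalfPlane),
        (z₁ : ℂ) = (s₁ : ℂ) + Complex.I / (ℓ₁ : ℂ) →
        (z₂ : ℂ) = (s₂ : ℂ) + Complex.I / (ℓ₂ : ℂ) →
        |dist z₁ z₂ - abs (Real.log (ℓ₁ / ℓ₂))| ≤ C := by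
  have coords (z : UpperHalfPlane) (s ℓ : ℝ) (h : (z : ℂ) = (s : ℂ) + Complex.I / (ℓ : ℂ)) :
      z.re = s ∧ z.im = ℓ⁻¹ := by
    rw [← UpperHalfPlane.coe_re, ← UpperHalfPlane.coe_im, h]
    simp [Complex.div_ofReal_re, Complex.div_ofReal_im]
  refine ⟨log (c + 2), log_pos (by linarith), fun s₁ s₂ ℓ₁ ℓ₂ h₁ h₂ h z₁ z₂ hz₁ hz₂ => ?_⟩
  obtain ⟨hre₁, him₁⟩ := coords z₁ s₁ ℓ₁ hz₁
  obtain ⟨hre₂, him₂⟩ := coords z₂ s₂ ℓ₂ hz₂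
  have hlog : |log (z₁.im / z₂.im)| = |log (ℓ₁ / ℓ₂)| := by
    rw [him₁, him₂, inv_div_inv, ← inv_div, log_inv, abs_neg]
  have hlower := UpperHalfPlane.dist_log_im_le z₁ z₂
  rw [Real.dist_eq, ← log_div z₁.im_ne_zero z₂.im_ne_zero, hlog] at hlower
  have hupper := UpperHalfPlane.dist_le_abs_log_add (c := c) (by linarith) z₁ z₂ (by
    rw [hre₁, hre₂, him₁, him₂, ← mul_inv, div_inv_eq_mul, ← mul_assoc]
    exact h)
  rw [hlog] at hupper
  rw [abs_of_nonneg (by linarith)]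
  linarith
end

section
/- For every c ≥ 1 there exists a constant C > 0, depending only on c, such that for all real numbers s₁, s₂ and all ℓ₁, ℓ₂ > 0 with |s₁ − s₂| ≤ c·(1/ℓ₁ + 1/ℓ₂), the points z₁ = s₁ + i/ℓ₁ and z₂ = s₂ + i/ℓ₂ of the hyperbolic upper half-plane satisfy |dist_ℍ(z₁, z₂) − |log(ℓ₁/ℓ₂)|| ≤ C. -/
open Real

/-- Two points at the same height are at most as far apart as the horizontal segment between them
is long. -/
lemma UpperHalfPlane.dist_le_abs_re_sub_div_im {z w : UpperHalfPlane} (h : z.im = w.im) :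
    dist z w ≤ |z.re - w.re| / z.im := by
  have hd : dist (z : ℂ) w = |z.re - w.re| := by
    rw [Complex.dist_of_im_eq (by simpa using h), Real.dist_eq]
    simp
  have := UpperHalfPlane.dist_le_dist_coe_div_sqrt z w
  rwa [← h, Real.sqrt_mul_self z.im_pos.le, hd] at this

/-- The distance is at most that along the path which first moves horizontally at the height of
`z` and then vertically. -/
lemma UpperHalfPlane.dist_le_abs_re_sub_div_im_add_dist_log_im (z w : UpperHalfPlane) :
    dist z w ≤ |z.re - w.re| / z.im + dist (log z.im) (log w.im) := by
  let p : UpperHalfPlane := ⟨⟨w.re, z.im⟩, z.im_pos⟩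
  have hzp : dist z p ≤ |z.re - w.re| / z.im :=
    UpperHalfPlane.dist_le_abs_re_sub_div_im (z := z) (w := p) rfl
  have hpw : dist p w = dist (log z.im) (log w.im) :=
    UpperHalfPlane.dist_of_re_eq (z := p) (w := w) rfl
  linarith [dist_triangle z p w]

lemma UpperHalfPlane.dist_le_two_mul_add_dist_log_im {c : ℝ} (hc : 0 ≤ c) (z w : UpperHalfPlane)
    (h : |z.re - w.re| ≤ c * (z.im + w.im)) :
    dist z w ≤ 2 * c + dist (log z.im) (log w.im) := by
  wlog hwz : w.im ≤ z.im generalizing z w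
  · rw [dist_comm z w, dist_comm (log z.im)]
    exact this w z (by rwa [abs_sub_comm, add_comm w.im]) (not_le.mp hwz).le
  have hdiv : |z.re - w.re| / z.im ≤ 2 * c := by
    rw [div_le_iff₀ z.im_pos]
    nlinarith
  linarith [UpperHalfPlane.dist_le_abs_re_sub_div_im_add_dist_log_im z w]

theorem H2_distance_twist_controlled_by_lengths (c : ℝ) (hc : 1 ≤ c) :
    ∃ C > 0, ∀ (s₁ s₂ ℓ₁ ℓ₂ : ℝ), 0 < ℓ₁ → 0 < ℓ₂ →
      |s₁ - s₂| ≤ c * (1 / ℓ₁ + 1 / ℓ₂) →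
      ∀ (z₁ z₂ : UpperHalfPlane),
        (z₁ : ℂ) = (s₁ : ℂ) + Complex.I / (ℓ₁ : ℂ) →
        (z₂ : ℂ) = (s₂ : ℂ) + Complex.I / (ℓ₂ : ℂ) →
        |dist z₁ z₂ - abs (Real.log (ℓ₁ / ℓ₂))| ≤ C := by
  refine ⟨2 * c, by linarith, fun s₁ s₂ ℓ₁ ℓ₂ h₁ h₂ h z₁ z₂ hz₁ hz₂ => ?_⟩
  have hcoord (z : UpperHalfPlane) (s ℓ : ℝ) (hz : (z : ℂ) = (s : ℂ) + Complex.I / (ℓ : ℂ)) :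
      z.re = s ∧ z.im = 1 / ℓ := by
    rw [← UpperHalfPlane.coe_re, ← UpperHalfPlane.coe_im, hz]
    simp [Complex.div_ofReal_re, Complex.div_ofReal_im]
  obtain ⟨hre₁, him₁⟩ := hcoord z₁ s₁ ℓ₁ hz₁
  obtain ⟨hre₂, him₂⟩ := hcoord z₂ s₂ ℓ₂ hz₂
  have hlog : dist (log z₁.im) (log z₂.im) = |log (ℓ₁ / ℓ₂)| := by
    rw [him₁, him₂, Real.dist_eq, one_div, one_div, log_inv, log_inv, log_div h₁.ne' h₂.ne',
      abs_sub_comm]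
    congr 1
    ring
  have hlower := UpperHalfPlane.dist_log_im_le z₁ z₂
  have hupper := UpperHalfPlane.dist_le_two_mul_add_dist_log_im (zero_le_one.trans hc) z₁ z₂
    (by rwa [hre₁, hre₂, him₁, him₂])
  rw [hlog] at hlower hupper
  rw [abs_le]
  constructor <;> linarith
end

section
/- For every c ≥ 1 there exists a constant C > 0, depending only on c, such that the following holds. Let v ≤ t₀ ≤ w be real numbers, let d₀ > 0, let ℓ_v, ℓ_w ∈ (0, 1], and let s_v, s_w be real numbers such that: (1/c)·e^{−2(t₀−v)}·d₀ ≤ 1/ℓ_v ≤ c·e^{−2(t₀−v)}·d₀; (1/c)·e^{−2(w−t₀)}·d₀ ≤ 1/ℓ_w ≤ c·e^{−2(w−t₀)}·d₀; and | |s_v − s_w| − d₀ | ≤ c·(1/ℓ_v + 1/ℓ_w) + c. Then the points z_v = s_v + i/ℓ_v and z_w = s_w + i/ℓ_w of the hyperbolic upper half-plane satisfy |dist_ℍ(z_v, z_w) − 2(w − v)| ≤ C. -/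
open Real

/-- The distance in the upper half-plane is `T` up to an additive error `log K` once
`2 cosh (dist z w)`, written in coordinates, is `exp T` up to a factor of order `K`. -/
lemma abs_dist_sub_le_log {z w : UpperHalfPlane} {K T : ℝ} (hK : 0 < K)
    (hupper : (z.re - w.re) ^ 2 + z.im ^ 2 + w.im ^ 2 ≤ K * exp T * (z.im * w.im))
    (hlower : 2 * exp T * (z.im * w.im) ≤ K * ((z.re - w.re) ^ 2 + z.im ^ 2 + w.im ^ 2)) :
    |dist z w - T| ≤ log K := by
  have him : 0 < z.im * w.im := mul_pos z.im_pos w.im_pos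
  have hcosh : (exp (dist z w) + exp (-dist z w)) * (z.im * w.im) =
      (z.re - w.re) ^ 2 + z.im ^ 2 + w.im ^ 2 := by
    have h := UpperHalfPlane.cosh_dist' z w
    rw [cosh_eq, eq_div_iff (by nlinarith)] at h
    linarith
  have hneg : exp (-dist z w) ≤ exp (dist z w) :=
    exp_le_exp.2 (by linarith [dist_nonneg (x := z) (y := w)])
  have h₁ : exp (dist z w) ≤ exp (log K + T) := by
    rw [exp_add, exp_log hK]
    refine le_of_mul_le_mul_right ?_ him
    nlinarith [mul_pos (exp_pos (-dist z w)) him]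
  have h₂ : exp T ≤ exp (log K + dist z w) := by
    rw [exp_add, exp_log hK]
    refine le_of_mul_le_mul_right ?_ him
    have := mul_le_mul_of_nonneg_right hneg (mul_pos hK him).le
    rw [← hcosh] at hlower
    linarith
  rw [exp_le_exp] at h₁ h₂
  rw [abs_le]
  constructor <;> linarith

/-- If the heights `y`, `y'` are at least `1` and at most of order `d`, and the horizontal
displacement `x` is `d` up to an error of order `y + y' + 1`, then `x² + y² + y'²` is at most of
order `d²`. -/
lemma sq_add_sq_add_sq_le {c d x y y' : ℝ} (hc : 1 ≤ c) (hy : 1 ≤ y) (hy' : 1 ≤ y')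
    (hyd : y ≤ c * d) (hyd' : y' ≤ c * d) (hx : |(|x| - d)| ≤ c * (y + y') + c) :
    x ^ 2 + y ^ 2 + y' ^ 2 ≤ 18 * c ^ 4 * d ^ 2 := by
  have hd : 0 < d := pos_of_mul_pos_right (by linarith : 0 < c * d) (by linarith)
  have hcc : c ≤ c ^ 2 := by nlinarith
  have hx' : |x| ≤ 4 * c ^ 2 * d := by
    have h := (abs_le.1 hx).2
    have h₁ := mul_le_mul_of_nonneg_left hyd (by linarith : 0 ≤ c)
    have h₂ := mul_le_mul_of_nonneg_left hyd' (by linarith : 0 ≤ c)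
    have h₃ := mul_le_mul_of_nonneg_left hy (by linarith : 0 ≤ c)
    nlinarith
  have hmono : c * d ≤ c ^ 2 * d := by gcongr
  have hx2 : x ^ 2 ≤ (4 * c ^ 2 * d) ^ 2 := by
    rw [← sq_abs x]
    gcongr
  have hy2 : y ^ 2 ≤ (c ^ 2 * d) ^ 2 := by
    gcongr
    linarith
  have hy2' : y' ^ 2 ≤ (c ^ 2 * d) ^ 2 := by
    gcongr
    linarith
  linarith

/-- If the heights are at least `1` and the horizontal displacement `x` is `d` up to an error of
order `y + y' + 1`, then `d²` is at most of order `x² + y² + y'²`. -/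
lemma sq_le_sq_add_sq_add_sq {c d x y y' : ℝ} (hc : 1 ≤ c) (hd : 0 < d) (hy : 1 ≤ y)
    (hy' : 1 ≤ y') (hx : |(|x| - d)| ≤ c * (y + y') + c) :
    d ^ 2 ≤ 12 * c ^ 2 * (x ^ 2 + y ^ 2 + y' ^ 2) := by
  have hsum : d ≤ 2 * c * (|x| + y + y') := by
    have h := (abs_le.1 hx).1
    have h₁ := mul_le_mul_of_nonneg_left hy (by linarith : 0 ≤ c)
    nlinarith [abs_nonneg x]
  have hcauchy : (|x| + y + y') ^ 2 ≤ 3 * (x ^ 2 + y ^ 2 + y' ^ 2) := by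
    rw [← sq_abs x]
    nlinarith [sq_nonneg (|x| - y), sq_nonneg (|x| - y'), sq_nonneg (y - y')]
  calc d ^ 2 ≤ (2 * c * (|x| + y + y')) ^ 2 := by gcongr
    _ = 4 * c ^ 2 * (|x| + y + y') ^ 2 := by ring
    _ ≤ 4 * c ^ 2 * (3 * (x ^ 2 + y ^ 2 + y' ^ 2)) := by gcongr
    _ = 12 * c ^ 2 * (x ^ 2 + y ^ 2 + y' ^ 2) := by ring

theorem H2_distance_balance_time_between (c : ℝ) (hc : 1 ≤ c) :
    ∃ C > 0, ∀ (v t₀ w d₀ ℓv ℓw sv sw : ℝ),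
      v ≤ t₀ → t₀ ≤ w → 0 < d₀ →
      0 < ℓv → ℓv ≤ 1 → 0 < ℓw → ℓw ≤ 1 →
      (1 / c) * Real.exp (-2 * (t₀ - v)) * d₀ ≤ 1 / ℓv →
      1 / ℓv ≤ c * Real.exp (-2 * (t₀ - v)) * d₀ →
      (1 / c) * Real.exp (-2 * (w - t₀)) * d₀ ≤ 1 / ℓw →
      1 / ℓw ≤ c * Real.exp (-2 * (w - t₀)) * d₀ →
      abs (|sv - sw| - d₀) ≤ c * (1 / ℓv + 1 / ℓw) + c →
      ∀ (zv zw : UpperHalfPlane),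
        (zv : ℂ) = (sv : ℂ) + Complex.I / (ℓv : ℂ) →
        (zw : ℂ) = (sw : ℂ) + Complex.I / (ℓw : ℂ) →
        |dist zv zw - 2 * (w - v)| ≤ C := by
  have hc₀ : 0 < c := by linarith
  have hc6 : 1 ≤ c ^ 6 := one_le_pow₀ hc
  refine ⟨log (24 * c ^ 6), log_pos (by linarith), ?_⟩
  intro v t₀ w d ℓv ℓw sv sw hv hw hd hℓv hℓv1 hℓw hℓw1 hvl hvu hwl hwu hs zv zw hzv hzw
  have hzv_re : zv.re = sv := by
    rw [← UpperHalfPlane.coe_re, hzv]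
    simp [Complex.div_re]
  have hzw_re : zw.re = sw := by
    rw [← UpperHalfPlane.coe_re, hzw]
    simp [Complex.div_re]
  have hzv_im : zv.im = 1 / ℓv := by
    rw [← UpperHalfPlane.coe_im, hzv]
    simp [Complex.div_ofReal_im]
  have hzw_im : zw.im = 1 / ℓw := by
    rw [← UpperHalfPlane.coe_im, hzw]
    simp [Complex.div_ofReal_im]
  have hy : 1 ≤ zv.im := hzv_im ▸ (one_le_div hℓv).2 hℓv1
  have hy' : 1 ≤ zw.im := hzw_im ▸ (one_le_div hℓw).2 hℓw1
  rw [← hzv_im] at hvl hvu hs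
  rw [← hzw_im] at hwl hwu hs
  rw [← hzv_re, ← hzw_re] at hs
  set p := exp (-2 * (t₀ - v)) with hp
  set q := exp (-2 * (w - t₀)) with hq
  have hp₀ : 0 < p := exp_pos _
  have hq₀ : 0 < q := exp_pos _
  have hp1 : p ≤ 1 := exp_le_one_iff.2 (by linarith)
  have hq1 : q ≤ 1 := exp_le_one_iff.2 (by linarith)
  have hpq : exp (2 * (w - v)) * (p * q) = 1 := by
    rw [hp, hq, ← exp_add, ← exp_add, exp_eq_one_iff]
    ring
  have hyd : zv.im ≤ c * d := hvu.trans (by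
    gcongr
    exact mul_le_of_le_one_right hc₀.le hp1)
  have hyd' : zw.im ≤ c * d := hwu.trans (by
    gcongr
    exact mul_le_of_le_one_right hc₀.le hq1)
  have hprod_le : exp (2 * (w - v)) * (zv.im * zw.im) ≤ c ^ 2 * d ^ 2 := by
    calc exp (2 * (w - v)) * (zv.im * zw.im)
        ≤ exp (2 * (w - v)) * ((c * p * d) * (c * q * d)) := by gcongr
      _ = exp (2 * (w - v)) * (p * q) * (c ^ 2 * d ^ 2) := by ring
      _ = c ^ 2 * d ^ 2 := by rw [hpq, one_mul]
  have hle_prod : d ^ 2 ≤ c ^ 2 * (exp (2 * (w - v)) * (zv.im * zw.im)) := by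
    calc d ^ 2 = exp (2 * (w - v)) * (p * q) * d ^ 2 := by rw [hpq, one_mul]
      _ = c ^ 2 * (exp (2 * (w - v)) * ((1 / c * p * d) * (1 / c * q * d))) := by field_simp
      _ ≤ c ^ 2 * (exp (2 * (w - v)) * (zv.im * zw.im)) := by gcongr
  have hc46 : c ^ 4 ≤ c ^ 6 := pow_le_pow_right₀ hc (by norm_num)
  refine abs_dist_sub_le_log (by positivity) ?_ ?_
  · calc (zv.re - zw.re) ^ 2 + zv.im ^ 2 + zw.im ^ 2 ≤ 18 * c ^ 4 * d ^ 2 :=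
          sq_add_sq_add_sq_le hc hy hy' hyd hyd' hs
      _ ≤ 24 * c ^ 4 * (c ^ 2 * (exp (2 * (w - v)) * (zv.im * zw.im))) := by
          gcongr
          norm_num
      _ = 24 * c ^ 6 * exp (2 * (w - v)) * (zv.im * zw.im) := by ring
  · calc 2 * exp (2 * (w - v)) * (zv.im * zw.im)
        = 2 * (exp (2 * (w - v)) * (zv.im * zw.im)) := by ring
      _ ≤ 2 * (c ^ 2 * (12 * c ^ 2 * ((zv.re - zw.re) ^ 2 + zv.im ^ 2 + zw.im ^ 2))) := by
          refine mul_le_mul_of_nonneg_left (hprod_le.trans ?_) zero_le_two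
          gcongr
          exact sq_le_sq_add_sq_add_sq hc hd hy hy' hs
      _ = 24 * c ^ 4 * ((zv.re - zw.re) ^ 2 + zv.im ^ 2 + zw.im ^ 2) := by ring
      _ ≤ 24 * c ^ 6 * ((zv.re - zw.re) ^ 2 + zv.im ^ 2 + zw.im ^ 2) := by gcongr
end

section
/- Let c ≥ 1, M > 0, t₀ ∈ ℝ, d₀ ≥ 0, and a ≤ b. Define D(t) = e^{−2|t−t₀|}·d₀, and let K : [a, b] → ℝ be continuous with K(t) > 0 for all t, satisfying: (a) K(t) ≤ c·e^{2|t−s|}·K(s) for all s, t ∈ [a, b]; (b) for all v ≤ w in [a, b], if t₀ ≤ v then K(w) ≤ c·K(v), and if w ≤ t₀ then K(v) ≤ c·K(w); (c) for all t ∈ [a, b], if c·√(K(t)) ≥ D(t) then K(t) > M. Then at least one of the following holds: (i) K(t) > M/c² for all t ∈ [a, b]; (ii) there exists u ∈ [a, b] such that D(t) ≥ √(K(t)) for all t ∈ [a, u] and √(K(b)) ≤ √(c·M)·e^{u−a}; (iii) there exists u ∈ [a, b] such that D(t) ≥ √(K(t)) for all t ∈ [u, b] and √(K(a)) ≤ √(c·M)·e^{b−u}.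 -/
open Real

/-- If `K` is at most `M / c ^ 2` at some time `w` after the balance time `t₀`, then
`exp (-2 * |t - t₀|) * d₀` dominates `√K` from `max a t₀` onwards, and `√(K a)` is controlled by the length of that interval. -/
lemma exists_terminal_dominated_interval {c M t₀ d₀ a b : ℝ} (hc : 1 ≤ c) (hd₀ : 0 ≤ d₀)
    {K : ℝ → ℝ} (hK_pos : ∀ t ∈ Set.Icc a b, 0 < K t)
    (hgrowth : ∀ s ∈ Set.Icc a b, ∀ t ∈ Set.Icc a b,
      K t ≤ c * Real.exp (2 * |t - s|) * K s)
    (hdecay : ∀ v ∈ Set.Icc a b, ∀ w ∈ Set.Icc a b, v ≤ w →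
      (t₀ ≤ v → K w ≤ c * K v) ∧ (w ≤ t₀ → K v ≤ c * K w))
    (hthreshold : ∀ t ∈ Set.Icc a b,
      c * √(K t) ≥ Real.exp (-2 * |t - t₀|) * d₀ → K t > M)
    {w : ℝ} (hw : w ∈ Set.Icc a b) (htw : t₀ ≤ w) (hKw : K w ≤ M / c ^ 2) :
    ∃ u ∈ Set.Icc a b, (∀ t ∈ Set.Icc u b, Real.exp (-2 * |t - t₀|) * d₀ ≥ √(K t)) ∧
      √(K a) ≤ √(c * M) * Real.exp (b - u) := by
  have hc0 : 0 < c := by linarith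
  obtain ⟨haw, hwb⟩ := hw
  have hab : a ≤ b := haw.trans hwb
  have ha_mem : a ∈ Set.Icc a b := ⟨le_rfl, hab⟩
  have hb_mem : b ∈ Set.Icc a b := ⟨hab, le_rfl⟩
  have hM : c ^ 2 * K w ≤ M := by
    rwa [le_div_iff₀ (by positivity), mul_comm] at hKw
  have hafter : ∀ t ∈ Set.Icc w b, c * K t ≤ M := fun t ht => by
    have := (hdecay w ⟨haw, hwb⟩ t ⟨haw.trans ht.1, ht.2⟩ ht.1).1 htw
    nlinarith
  have hstrict : ∀ t ∈ Set.Icc w b, c * √(K t) < Real.exp (-2 * |t - t₀|) * d₀ := fun t ht => by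
    have hmem : t ∈ Set.Icc a b := ⟨haw.trans ht.1, ht.2⟩
    by_contra! h
    have h₁ := hthreshold t hmem h
    have h₂ := hafter t ht
    nlinarith [hK_pos t hmem]
  have hmax : max a t₀ ≤ w := max_le haw htw
  have hu_mem : max a t₀ ∈ Set.Icc a b := ⟨le_max_left _ _, hmax.trans hwb⟩
  refine ⟨max a t₀, hu_mem, fun t ht => ?_, ?_⟩
  · have hmem : t ∈ Set.Icc a b := ⟨hu_mem.1.trans ht.1, ht.2⟩
    rcases le_total w t with hwt | htw'
    · have := hstrict t ⟨hwt, ht.2⟩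
      nlinarith [Real.sqrt_nonneg (K t)]
    · have ht₀ : t₀ ≤ t := (le_max_right _ _).trans ht.1
      have hg := hgrowth w ⟨haw, hwb⟩ t hmem
      rw [abs_sub_comm, abs_of_nonneg (sub_nonneg.2 htw')] at hg
      have hDw := hstrict w ⟨le_rfl, hwb⟩
      have hDt : Real.exp (-2 * |t - t₀|) * d₀ =
          Real.exp (2 * (w - t)) * (Real.exp (-2 * |w - t₀|) * d₀) := by
        rw [← mul_assoc, ← Real.exp_add, abs_of_nonneg (sub_nonneg.2 ht₀),
          abs_of_nonneg (sub_nonneg.2 htw)]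
        ring_nf
      have hE : 1 ≤ Real.exp (2 * (w - t)) := Real.one_le_exp (by linarith)
      have hsq : c ^ 2 * K w ≤ (Real.exp (-2 * |w - t₀|) * d₀) ^ 2 := by
        rw [← Real.sq_sqrt (hK_pos w ⟨haw, hwb⟩).le, ← mul_pow]
        gcongr
      refine Real.sqrt_le_iff.2 ⟨by positivity, ?_⟩
      rw [hDt]
      generalize Real.exp (2 * (w - t)) = E at *
      generalize Real.exp (-2 * |w - t₀|) * d₀ = x at *
      calc K t ≤ c * K t := le_mul_of_one_le_left (hK_pos t hmem).le hc
        _ ≤ c * (c * E * K w) := by gcongr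
        _ = E * (c ^ 2 * K w) := by ring
        _ ≤ E * x ^ 2 := by gcongr
        _ ≤ E * (E * x ^ 2) := le_mul_of_one_le_left (by positivity) hE
        _ = (E * x) ^ 2 := by ring
  · have hKa : K a ≤ c * K (max a t₀) := by
      rcases le_total t₀ a with h | h
      · rw [max_eq_left h]
        exact le_mul_of_one_le_left (hK_pos a ha_mem).le hc
      · rw [max_eq_right h] at hu_mem ⊢
        exact (hdecay a ha_mem t₀ hu_mem h).2 le_rfl
    have hg := hgrowth b hb_mem _ hu_mem
    rw [abs_sub_comm, abs_of_nonneg (sub_nonneg.2 hu_mem.2)] at hg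
    have hM0 : 0 ≤ M := le_trans (mul_pos hc0 (hK_pos b hb_mem)).le (hafter b ⟨hwb, le_rfl⟩)
    refine Real.sqrt_le_iff.2 ⟨by positivity, ?_⟩
    rw [mul_pow, Real.sq_sqrt (by positivity), ← Real.exp_nat_mul, Nat.cast_ofNat]
    have hE := Real.exp_nonneg (2 * (b - max a t₀))
    generalize Real.exp (2 * (b - max a t₀)) = E at *
    calc K a ≤ c * (c * E * K b) := hKa.trans (by gcongr)
      _ = c * E * (c * K b) := by ring
      _ ≤ c * E * M := by gcongr; exact hafter b ⟨hwb, le_rfl⟩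
      _ = c * M * E := by ring

theorem dichotomy_lemma (c : ℝ) (hc : 1 ≤ c) (M : ℝ) (hM : 0 < M)
    (t₀ d₀ a b : ℝ) (hd₀ : 0 ≤ d₀) (hab : a ≤ b)
    (D : ℝ → ℝ) (hD : ∀ t, D t = Real.exp (-2 * |t - t₀|) * d₀)
    (K : ℝ → ℝ)
    (hK_cont : ContinuousOn K (Set.Icc a b))
    (hK_pos : ∀ t ∈ Set.Icc a b, 0 < K t)
    (ha : ∀ s ∈ Set.Icc a b, ∀ t ∈ Set.Icc a b,
      K t ≤ c * Real.exp (2 * |t - s|) * K s)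
    (hb : ∀ v ∈ Set.Icc a b, ∀ w ∈ Set.Icc a b, v ≤ w →
      (t₀ ≤ v → K w ≤ c * K v) ∧ (w ≤ t₀ → K v ≤ c * K w))
    (hc' : ∀ t ∈ Set.Icc a b, c * Real.sqrt (K t) ≥ D t → K t > M) :
    (∀ t ∈ Set.Icc a b, K t > M / c ^ 2) ∨
    (∃ u ∈ Set.Icc a b, (∀ t ∈ Set.Icc a u, D t ≥ Real.sqrt (K t)) ∧
      Real.sqrt (K b) ≤ Real.sqrt (c * M) * Real.exp (u - a)) ∨
    (∃ u ∈ Set.Icc a b, (∀ t ∈ Set.Icc u b, D t ≥ Real.sqrt (K t)) ∧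
      Real.sqrt (K a) ≤ Real.sqrt (c * M) * Real.exp (b - u)) := by
  obtain rfl : D = fun t => Real.exp (-2 * |t - t₀|) * d₀ := funext hD
  rw [or_iff_not_imp_left]
  intro h
  push Not at h
  obtain ⟨w, hw, hKw⟩ := h
  rcases le_total t₀ w with htw | hwt
  · exact Or.inr (exists_terminal_dominated_interval hc hd₀ hK_pos ha hb hc' hw htw hKw)
  · have hneg : ∀ {t}, t ∈ Set.Icc (-b) (-a) → -t ∈ Set.Icc a b := fun ht =>
      ⟨by linarith [ht.2], by linarith [ht.1]⟩
    have habs : ∀ s t : ℝ, |-t - s| = |t - -s| := fun s t => by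
      rw [← abs_neg]
      ring_nf
    obtain ⟨u, hu, hdom, hbound⟩ := exists_terminal_dominated_interval
      (K := fun t => K (-t)) (M := M) (t₀ := -t₀) (a := -b) (b := -a) (w := -w) hc hd₀
      (fun t ht => hK_pos _ (hneg ht))
      (fun s hs t ht => by simpa only [habs, neg_neg] using ha _ (hneg hs) _ (hneg ht))
      (fun v hv w hw hvw =>
        have h := hb _ (hneg hw) _ (hneg hv) (neg_le_neg hvw)
        ⟨fun hv₀ => h.2 (by linarith), fun hw₀ => h.1 (by linarith)⟩)
      (fun t ht h => hc' _ (hneg ht) (by simpa only [habs] using h))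
      ⟨neg_le_neg hw.2, neg_le_neg hw.1⟩ (neg_le_neg hwt) (by simpa using hKw)
    refine Or.inl ⟨-u, hneg hu, fun t ht => ?_, ?_⟩
    · have := hdom (-t) ⟨by linarith [ht.2], neg_le_neg ht.1⟩
      simpa only [habs, neg_neg] using this
    · rw [neg_neg] at hbound
      rwa [show -u - a = -a - u by ring]
end

section
/- For every c ≥ 1 there exists a constant C > 0, depending only on c, such that the following holds. Let v ≤ w be real numbers, let ℓ_v, ℓ_w > 0 satisfy ℓ_v/ℓ_w ≤ c·e^{w−v} and ℓ_w/ℓ_v ≤ c·e^{w−v}, and let s_v, s_w be real numbers with |s_v − s_w| ≤ c·(1/ℓ_v + 1/ℓ_w). Then the points z_v = s_v + i/ℓ_v and z_w = s_w + i/ℓ_w of the hyperbolic upper half-plane satisfy dist_ℍ(z_v, z_w) ≤ (w − v) + C. -/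
open Real

/-- If the horizontal displacement of two points of the upper half-plane is at most `c` times the
sum of their heights, their distance is controlled by the ratio of the heights. -/
theorem UpperHalfPlane.exp_dist_le_of_abs_re_sub_le {c : ℝ} (hc : 1 ≤ c) (z w : UpperHalfPlane)
    (h : |z.re - w.re| ≤ c * (z.im + w.im)) :
    exp (dist z w) ≤ 2 * c ^ 2 * (z.im / w.im + w.im / z.im + 2) := by
  have hz := z.im_pos
  have hw := w.im_pos
  have hsq : (z.re - w.re) ^ 2 ≤ (c * (z.im + w.im)) ^ 2 := sq_le_sq' (abs_le.mp h).1 (abs_le.mp h).2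
  have hexp : exp (dist z w) ≤ 2 * cosh (dist z w) := by
    rw [cosh_eq]
    linarith [exp_pos (-dist z w)]
  have hnum : (z.re - w.re) ^ 2 + z.im ^ 2 + w.im ^ 2 ≤ 2 * c ^ 2 * (z.im + w.im) ^ 2 := by
    have hc2 : 1 ≤ c ^ 2 := one_le_pow₀ hc
    nlinarith [mul_pos hz hw, mul_nonneg (sub_nonneg.mpr hc2) (sq_nonneg (z.im + w.im))]
  calc exp (dist z w) ≤ 2 * cosh (dist z w) := hexp
    _ ≤ 2 * (2 * c ^ 2 * (z.im + w.im) ^ 2 / (2 * z.im * w.im)) := by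
      rw [UpperHalfPlane.cosh_dist']
      gcongr
    _ = 2 * c ^ 2 * (z.im / w.im + w.im / z.im + 2) := by
      field_simp
      ring

theorem H2_distance_upper_bound_sqrtK_case (c : ℝ) (hc : 1 ≤ c) :
    ∃ C > 0, ∀ (v w ℓv ℓw sv sw : ℝ),
      v ≤ w → 0 < ℓv → 0 < ℓw →
      ℓv / ℓw ≤ c * Real.exp (w - v) →
      ℓw / ℓv ≤ c * Real.exp (w - v) →
      |sv - sw| ≤ c * (1 / ℓv + 1 / ℓw) →
      ∀ (zv zw : UpperHalfPlane),
        (zv : ℂ) = (sv : ℂ) + Complex.I / (ℓv : ℂ) →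
        (zw : ℂ) = (sw : ℂ) + Complex.I / (ℓw : ℂ) →
        dist zv zw ≤ (w - v) + C := by
  have hc3 : 1 ≤ c ^ 3 := one_le_pow₀ hc
  refine ⟨log (8 * c ^ 3), log_pos (by linarith), ?_⟩
  intro v w ℓv ℓw sv sw hvw hv hw hvw_ratio hwv_ratio hs zv zw hzv hzw
  have re_im {z : UpperHalfPlane} {s ℓ : ℝ} (hz : (z : ℂ) = (s : ℂ) + Complex.I / (ℓ : ℂ)) :
      z.re = s ∧ z.im = 1 / ℓ := by
    rw [← UpperHalfPlane.coe_re, ← UpperHalfPlane.coe_im, hz]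
    simp [Complex.div_ofReal_re, Complex.div_ofReal_im]
  obtain ⟨hv_re, hv_im⟩ := re_im hzv
  obtain ⟨hw_re, hw_im⟩ := re_im hzw
  have hdist := UpperHalfPlane.exp_dist_le_of_abs_re_sub_le hc zv zw
    (by rwa [hv_re, hw_re, hv_im, hw_im])
  rw [hv_im, hw_im, div_div_div_eq, div_div_div_eq, one_mul, one_mul, mul_one, mul_one] at hdist
  have hone : 1 ≤ c * exp (w - v) :=
    one_le_mul_of_one_le_of_one_le hc (one_le_exp (sub_nonneg.mpr hvw))
  rw [← exp_le_exp, exp_add, exp_log (by positivity)]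
  calc exp (dist zv zw) ≤ 2 * c ^ 2 * (ℓw / ℓv + ℓv / ℓw + 2) := hdist
    _ ≤ 2 * c ^ 2 * (4 * (c * exp (w - v))) := by
      gcongr
      linarith
    _ = exp (w - v) * (8 * c ^ 3) := by ring
end

section
/- For every c ≥ 1 and every M > 1 there exists a constant C > 0, depending only on c and M, such that the following holds. Let a ≤ b be real numbers, let K_a, K_b ≥ M satisfy K_a ≤ c·e^{2(b−a)}·K_b and K_b ≤ c·e^{2(b−a)}·K_a, let ℓ_a, ℓ_b > 0 satisfy 1/(c·log K_t) ≤ ℓ_t ≤ c/(log K_t) for t ∈ {a, b}, and let s_a, s_b be real numbers with (s_a − s_b)²·ℓ_a·ℓ_b ≤ c. Then the points z_a = s_a + i/ℓ_a and z_b = s_b + i/ℓ_b of the hyperbolic upper half-plane satisfy dist_ℍ(z_a, z_b) ≤ C·log(b − a + 2). -/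
open Real

/-- If `K ≤ c e^{2x} K'` with `K' ≥ M > 1`, then `log K / log K'` grows at most linearly in `x`. -/
lemma log_le_linear_mul_log {c M K K' x : ℝ} (hc : 1 ≤ c) (hM : 1 < M) (hx : 0 ≤ x)
    (hK : 0 < K) (hK' : M ≤ K') (h : K ≤ c * exp (2 * x) * K') :
    log K ≤ (1 + (log c + 2) / log M) * (x + 2) * log K' := by
  have hlogM : 0 < log M := log_pos hM
  have hlogc : 0 ≤ log c := log_nonneg hc
  have hlog : log M ≤ log K' := log_le_log (by linarith) hK'
  have hlogK : log K ≤ log c + 2 * x + log K' := by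
    have h' := log_le_log hK h
    rwa [log_mul (by positivity) (by linarith), log_mul (by linarith) (exp_pos _).ne',
      log_exp] at h'
  have hquot : log c + 2 ≤ (log c + 2) / log M * log K' := by
    rw [div_mul_eq_mul_div, le_div_iff₀ hlogM]
    gcongr
  calc log K ≤ log c + 2 * x + log K' := hlogK
    _ ≤ (log c + 2) * (x + 2) + (x + 2) * log K' := by nlinarith
    _ ≤ (log c + 2) / log M * log K' * (x + 2) + (x + 2) * log K' := by gcongr
    _ = _ := by ring

/-- If `ℓ ≤ c / L` and `1 / (c L') ≤ ℓ'`, a bound on `L' / L` gives one on `ℓ / ℓ'`. -/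
lemma div_le_sq_mul_of_comparable_inv {c L L' l l' R : ℝ} (hc : 0 < c) (hL : 0 < L)
    (hL' : 0 < L') (hl' : 0 < l') (h : l ≤ c / L) (h' : 1 / (c * L') ≤ l')
    (hR : L' ≤ R * L) : l / l' ≤ c ^ 2 * R := by
  rw [div_le_iff₀ hl']
  have hRL : L' / L ≤ R := (div_le_iff₀ hL).2 hR
  have hR0 : 0 ≤ R := (div_pos hL' hL).le.trans hRL
  calc l ≤ c / L := h
    _ = c ^ 2 * (L' / L) * (1 / (c * L')) := by field_simp
    _ ≤ c ^ 2 * R * l' := by gcongr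

/-- An exponential bound on the distance between `s + i/l` and `s' + i/l'`. -/
lemma UpperHalfPlane.exp_dist_le_of_eq_add_I_div {s s' l l' : ℝ} (hl : 0 < l) (hl' : 0 < l')
    {z w : UpperHalfPlane} (hz : (z : ℂ) = (s : ℂ) + Complex.I / (l : ℂ))
    (hw : (w : ℂ) = (s' : ℂ) + Complex.I / (l' : ℂ)) :
    exp (dist z w) ≤ (s - s') ^ 2 * l * l' + l / l' + l' / l := by
  have re_eq {u : UpperHalfPlane} {t r : ℝ} (hu : (u : ℂ) = (t : ℂ) + Complex.I / (r : ℂ)) :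
      u.re = t := by
    rw [← UpperHalfPlane.coe_re, hu]; simp
  have im_eq {u : UpperHalfPlane} {t r : ℝ} (hu : (u : ℂ) = (t : ℂ) + Complex.I / (r : ℂ)) :
      u.im = 1 / r := by
    rw [← UpperHalfPlane.coe_im, hu]; simp
  have hcosh := UpperHalfPlane.cosh_dist' z w
  rw [re_eq hz, re_eq hw, im_eq hz, im_eq hw, Real.cosh_eq] at hcosh
  have hsum : ((s - s') ^ 2 + (1 / l) ^ 2 + (1 / l') ^ 2) / (2 * (1 / l) * (1 / l')) =
      ((s - s') ^ 2 * l * l' + l / l' + l' / l) / 2 := by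
    field_simp
    ring
  linarith [exp_pos (-dist z w)]

theorem H2_distance_log_bound_expanding_annulus (c : ℝ) (hc : 1 ≤ c) (M : ℝ) (hM : 1 < M) :
    ∃ C > 0, ∀ (a b Ka Kb ℓa ℓb sa sb : ℝ),
      a ≤ b → M ≤ Ka → M ≤ Kb →
      Ka ≤ c * Real.exp (2 * (b - a)) * Kb →
      Kb ≤ c * Real.exp (2 * (b - a)) * Ka →
      0 < ℓa → 0 < ℓb →
      1 / (c * Real.log Ka) ≤ ℓa → ℓa ≤ c / Real.log Ka →
      1 / (c * Real.log Kb) ≤ ℓb → ℓb ≤ c / Real.log Kb →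
      (sa - sb) ^ 2 * ℓa * ℓb ≤ c →
      ∀ (za zb : UpperHalfPlane),
        (za : ℂ) = (sa : ℂ) + Complex.I / (ℓa : ℂ) →
        (zb : ℂ) = (sb : ℂ) + Complex.I / (ℓb : ℂ) →
        dist za zb ≤ C * Real.log (b - a + 2) := by
  have hlogM : 0 < log M := log_pos hM
  have hlogc : 0 ≤ log c := log_nonneg hc
  have hlog2 : 0 < log 2 := log_pos one_lt_two
  set D : ℝ := 1 + (log c + 2) / log M
  have hD1 : 1 ≤ D := le_add_of_nonneg_right (by positivity)
  have hE : 1 ≤ 3 * c ^ 2 * D := by nlinarith [one_le_pow₀ hc (n := 2)]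
  have hlogE : 0 ≤ log (3 * c ^ 2 * D) := log_nonneg hE
  refine ⟨log (3 * c ^ 2 * D) / log 2 + 1, by positivity, ?_⟩
  intro a b Ka Kb ℓa ℓb sa sb hab hKa hKb hKab hKba hℓa hℓb hla hua hlb hub hs za zb hza hzb
  have hT : 2 ≤ b - a + 2 := by linarith
  have hlogT : log 2 ≤ log (b - a + 2) := log_le_log two_pos hT
  have hLa : 0 < log Ka := log_pos (by linarith)
  have hLb : 0 < log Kb := log_pos (by linarith)
  have hratio_ab : ℓa / ℓb ≤ c ^ 2 * (D * (b - a + 2)) :=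
    div_le_sq_mul_of_comparable_inv (by linarith) hLa hLb hℓb hua hlb
      (log_le_linear_mul_log hc hM (by linarith) (by linarith) hKa hKba)
  have hratio_ba : ℓb / ℓa ≤ c ^ 2 * (D * (b - a + 2)) :=
    div_le_sq_mul_of_comparable_inv (by linarith) hLb hLa hℓa hub hla
      (log_le_linear_mul_log hc hM (by linarith) (by linarith) hKb hKab)
  have hc_le : c ≤ c ^ 2 * (D * (b - a + 2)) := by
    have hDT : 1 ≤ D * (b - a + 2) := by nlinarith
    nlinarith
  have hexp : exp (dist za zb) ≤ 3 * c ^ 2 * D * (b - a + 2) := by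
    linarith [UpperHalfPlane.exp_dist_le_of_eq_add_I_div hℓa hℓb hza hzb]
  calc dist za zb ≤ log (3 * c ^ 2 * D * (b - a + 2)) :=
        (le_log_iff_exp_le (by positivity)).2 hexp
    _ = log (3 * c ^ 2 * D) / log 2 * log 2 + log (b - a + 2) := by
        rw [log_mul (by positivity) (by positivity), div_mul_cancel₀ _ hlog2.ne']
    _ ≤ log (3 * c ^ 2 * D) / log 2 * log (b - a + 2) + log (b - a + 2) := by gcongr
    _ = (log (3 * c ^ 2 * D) / log 2 + 1) * log (b - a + 2) := by ring
end

section
/- For every c ≥ 1 there exists a constant C > 0, depending only on c, such that the following holds. Let v ≤ w and t₀ be real numbers, let d₀ ≥ 0, let ℓ_v, ℓ_w ∈ (0, 1], let s_v, s_w be real numbers, and let p_v, p_w, m_v, m_w be real numbers such that: (length) (1/c)·e^{−2|t−t₀|}·d₀ ≤ 1/ℓ_t ≤ c·e^{−2|t−t₀|}·d₀ for t ∈ {v, w}; (twist difference) |(s_v − s_w) − (p_v − p_w)| ≤ c and |(s_v − s_w) − (m_v − m_w)| ≤ c; (relative twist) | |p_t − m_t| − d₀ | ≤ c for t ∈ {v,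 w}; (twist bounds) for t ∈ {v, w}, if t ≥ t₀ then |p_t| ≤ c/ℓ_t, and if t ≤ t₀ then |m_t| ≤ c/ℓ_t. Then the points z_v = s_v + i/ℓ_v and z_w = s_w + i/ℓ_w of the hyperbolic upper half-plane satisfy |dist_ℍ(z_v, z_w) − 2(w − v)| ≤ C. -/
open Real

/-- If `(z.re - w.re)² + z.im² + w.im²` is comparable to `R²` and
`z.im * w.im` is comparable to `exp (-T) * R²`, then `dist z w` is `T` up to a bounded error. -/
theorem abs_dist_sub_le_of_comparable {z w : UpperHalfPlane} {K R T : ℝ} (hK : 1 ≤ K)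
    (hR : 0 < R)
    (hlow : R ^ 2 ≤ K * ((z.re - w.re) ^ 2 + z.im ^ 2 + w.im ^ 2))
    (hupp : (z.re - w.re) ^ 2 + z.im ^ 2 + w.im ^ 2 ≤ K * R ^ 2)
    (him_low : exp (-T) * R ^ 2 ≤ K * (z.im * w.im))
    (him_upp : z.im * w.im ≤ K * (exp (-T) * R ^ 2)) :
    |dist z w - T| ≤ log (2 * K ^ 2) := by
  have hz := z.im_pos
  have hw := w.im_pos
  have hK0 : 0 < K := by linarith
  have hzw : 0 < z.im * w.im := mul_pos hz hw
  have hcosh := UpperHalfPlane.cosh_dist' z w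
  set S := (z.re - w.re) ^ 2 + z.im ^ 2 + w.im ^ 2 with hS
  set P := z.im * w.im with hP
  set E := exp T with hE
  have hE0 : 0 < E := exp_pos T
  rw [exp_neg, ← hE] at him_low him_upp
  have hcosh' : cosh (dist z w) * (2 * P) = S := by
    rw [hcosh, hP, hS]
    field_simp
  have hR2 : 0 < R ^ 2 := by positivity
  have him_low' : R ^ 2 ≤ K * P * E := by
    have := mul_le_mul_of_nonneg_right him_low hE0.le
    have h : E⁻¹ * R ^ 2 * E = R ^ 2 := by field_simp
    linarith
  have him_upp' : P * E ≤ K * R ^ 2 := by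
    have := mul_le_mul_of_nonneg_right him_upp hE0.le
    have h : K * (E⁻¹ * R ^ 2) * E = K * R ^ 2 := by field_simp
    linarith
  have hd : 0 ≤ dist z w := dist_nonneg
  have hexp_upp : exp (dist z w) ≤ 2 * cosh (dist z w) := by
    rw [cosh_eq]
    linarith [exp_pos (-dist z w)]
  have hexp_low : cosh (dist z w) ≤ exp (dist z w) := by
    rw [cosh_eq]
    linarith [exp_le_exp.2 (show -dist z w ≤ dist z w by linarith)]
  have hupper : exp (dist z w) ≤ 2 * K ^ 2 * E := by
    have h : 2 * cosh (dist z w) * P ≤ K ^ 2 * E * P := by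
      calc 2 * cosh (dist z w) * P = S := by linarith
        _ ≤ K * R ^ 2 := hupp
        _ ≤ K * (K * P * E) := by gcongr
        _ = K ^ 2 * E * P := by ring
    have h' := le_of_mul_le_mul_right h hzw
    have : 0 < K ^ 2 * E := by positivity
    linarith
  have hlower : E ≤ 2 * K ^ 2 * exp (dist z w) := by
    have h : E * P ≤ 2 * K ^ 2 * cosh (dist z w) * P := by
      calc E * P = P * E := mul_comm _ _
        _ ≤ K * R ^ 2 := him_upp'
        _ ≤ K * (K * S) := by gcongr
        _ = 2 * K ^ 2 * cosh (dist z w) * P := by rw [← hcosh']; ring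
    refine (le_of_mul_le_mul_right h hzw).trans ?_
    gcongr
  have hM : 0 < 2 * K ^ 2 := by positivity
  rw [← exp_log hM, hE, ← exp_add, exp_le_exp] at hupper hlower
  rw [abs_le]
  constructor <;> linarith

/-- Quadratic bounds when the two imaginary scales are ordered and the horizontal displacement
is controlled by them. -/
theorem sq_bounds_of_displacement_le {c a b A B s : ℝ} (hc : 1 ≤ c) (ha : 1 ≤ a) (hb : 0 ≤ b)
    (hAa : A ≤ c * a) (haA : a ≤ c * A) (hbB : b ≤ c * B) (hBA : B ≤ A) (hA : 0 ≤ A)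
    (hs : |s| ≤ c + c * a + c * b) :
    A ^ 2 ≤ 27 * c ^ 4 * (s ^ 2 + a ^ 2 + b ^ 2) ∧
      s ^ 2 + a ^ 2 + b ^ 2 ≤ 27 * c ^ 4 * A ^ 2 := by
  have hc0 : 0 < c := by linarith
  have hc2 : c ^ 2 ≤ c ^ 4 := pow_le_pow_right₀ hc (by norm_num)
  have hbA : b ≤ c * A := hbB.trans (by gcongr)
  constructor
  · calc A ^ 2 ≤ (c * a) ^ 2 := by gcongr
      _ = c ^ 2 * a ^ 2 := by ring
      _ ≤ 27 * c ^ 4 * (s ^ 2 + a ^ 2 + b ^ 2) := by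
        gcongr
        · linarith [pow_pos hc0 4]
        · linarith [sq_nonneg s, sq_nonneg b]
  · have hs' : |s| ≤ 3 * c ^ 2 * A := by
      calc |s| ≤ c + c * a + c * b := hs
        _ ≤ c * a + c * a + c * b := by gcongr; nlinarith
        _ ≤ c * (c * A) + c * (c * A) + c * (c * A) := by gcongr
        _ = 3 * c ^ 2 * A := by ring
    calc s ^ 2 + a ^ 2 + b ^ 2 = |s| ^ 2 + a ^ 2 + b ^ 2 := by rw [sq_abs]
      _ ≤ (3 * c ^ 2 * A) ^ 2 + (c * A) ^ 2 + (c * A) ^ 2 := by gcongr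
      _ = (9 * c ^ 4 + 2 * c ^ 2) * A ^ 2 := by ring
      _ ≤ 27 * c ^ 4 * A ^ 2 := by
        gcongr
        linarith [pow_pos hc0 4]

/-- Quadratic bounds when the horizontal displacement equals `d` up to an error controlled by
the imaginary parts. -/
theorem sq_bounds_of_displacement_near {c a b d s : ℝ} (hc : 1 ≤ c) (ha : 1 ≤ a) (hb : 0 ≤ b)
    (hd : 0 ≤ d) (had : a ≤ c * d) (hbd : b ≤ c * d)
    (hs : |(|s| - d)| ≤ 2 * c + c * a + c * b) :
    d ^ 2 ≤ 27 * c ^ 4 * (s ^ 2 + a ^ 2 + b ^ 2) ∧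
      s ^ 2 + a ^ 2 + b ^ 2 ≤ 27 * c ^ 4 * d ^ 2 := by
  have hc0 : 0 < c := by linarith
  have hc2 : c ^ 2 ≤ c ^ 4 := pow_le_pow_right₀ hc (by norm_num)
  have hc1 : 1 ≤ c ^ 2 := one_le_pow₀ hc
  have hca : c ≤ c * a := le_mul_of_one_le_right hc0.le ha
  obtain ⟨hs₁, hs₂⟩ := abs_le.1 hs
  constructor
  · have h : d ≤ |s| + 3 * (c * a) + c * b := by linarith
    calc d ^ 2 ≤ (|s| + 3 * (c * a) + c * b) ^ 2 := by gcongr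
      _ ≤ 3 * (|s| ^ 2 + 9 * (c * a) ^ 2 + (c * b) ^ 2) := by
        linarith [sq_nonneg (|s| - 3 * (c * a)), sq_nonneg (|s| - c * b),
          sq_nonneg (3 * (c * a) - c * b)]
      _ = 3 * s ^ 2 + 27 * c ^ 2 * a ^ 2 + 3 * c ^ 2 * b ^ 2 := by rw [sq_abs]; ring
      _ ≤ 27 * c ^ 4 * s ^ 2 + 27 * c ^ 4 * a ^ 2 + 27 * c ^ 4 * b ^ 2 := by
        gcongr <;> linarith
      _ = 27 * c ^ 4 * (s ^ 2 + a ^ 2 + b ^ 2) := by ring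
  · have hs' : |s| ≤ 5 * c ^ 2 * d := by
      calc |s| ≤ 1 * d + 3 * (c * a) + c * b := by linarith
        _ ≤ c ^ 2 * d + 3 * (c * (c * d)) + c * (c * d) := by gcongr
        _ = 5 * c ^ 2 * d := by ring
    calc s ^ 2 + a ^ 2 + b ^ 2 = |s| ^ 2 + a ^ 2 + b ^ 2 := by rw [sq_abs]
      _ ≤ (5 * c ^ 2 * d) ^ 2 + (c * d) ^ 2 + (c * d) ^ 2 := by gcongr
      _ = (25 * c ^ 4 + 2 * c ^ 2) * d ^ 2 := by ring
      _ ≤ 27 * c ^ 4 * d ^ 2 := by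
        gcongr
        linarith

theorem H2_distance_D_dominant_case (c : ℝ) (hc : 1 ≤ c) :
    ∃ C > 0, ∀ (v w t₀ d₀ ℓv ℓw sv sw pv pw mv mw : ℝ),
      v ≤ w → 0 ≤ d₀ →
      0 < ℓv → ℓv ≤ 1 → 0 < ℓw → ℓw ≤ 1 →
      (1 / c) * Real.exp (-2 * |v - t₀|) * d₀ ≤ 1 / ℓv →
      1 / ℓv ≤ c * Real.exp (-2 * |v - t₀|) * d₀ →
      (1 / c) * Real.exp (-2 * |w - t₀|) * d₀ ≤ 1 / ℓw →
      1 / ℓw ≤ c * Real.exp (-2 * |w - t₀|) * d₀ →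
      |(sv - sw) - (pv - pw)| ≤ c →
      |(sv - sw) - (mv - mw)| ≤ c →
      abs (|pv - mv| - d₀) ≤ c →
      abs (|pw - mw| - d₀) ≤ c →
      (t₀ ≤ v → |pv| ≤ c / ℓv) → (v ≤ t₀ → |mv| ≤ c / ℓv) →
      (t₀ ≤ w → |pw| ≤ c / ℓw) → (w ≤ t₀ → |mw| ≤ c / ℓw) →
      ∀ (zv zw : UpperHalfPlane),
        (zv : ℂ) = (sv : ℂ) + Complex.I / (ℓv : ℂ) →
        (zw : ℂ) = (sw : ℂ) + Complex.I / (ℓw : ℂ) →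
        |dist zv zw - 2 * (w - v)| ≤ C := by
  have hc0 : 0 < c := by linarith
  have hc4 : 1 ≤ c ^ 4 := one_le_pow₀ hc
  have hc24 : c ^ 2 ≤ c ^ 4 := pow_le_pow_right₀ hc (by norm_num)
  have hK : 1 ≤ 27 * c ^ 4 := by linarith
  refine ⟨log (2 * (27 * c ^ 4) ^ 2), log_pos (by nlinarith), ?_⟩
  intro v w t₀ d₀ ℓv ℓw sv sw pv pw mv mw hvw hd₀ hℓv hℓv1 hℓw hℓw1 hAa haA hBb hbB hp hm
    hpmv hpmw hpv hmv hpw hmw zv zw hzv hzw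
  have hzv_re : zv.re = sv := by
    rw [← UpperHalfPlane.coe_re, hzv]
    simp [Complex.div_re]
  have hzw_re : zw.re = sw := by
    rw [← UpperHalfPlane.coe_re, hzw]
    simp [Complex.div_re]
  have hzv_im : zv.im = 1 / ℓv := by
    rw [← UpperHalfPlane.coe_im, hzv, Complex.add_im, Complex.div_ofReal_im]
    simp
  have hzw_im : zw.im = 1 / ℓw := by
    rw [← UpperHalfPlane.coe_im, hzw, Complex.add_im, Complex.div_ofReal_im]
    simp
  have ha : 1 ≤ 1 / ℓv := (one_le_div hℓv).2 hℓv1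
  have hb : 1 ≤ 1 / ℓw := (one_le_div hℓw).2 hℓw1
  rw [div_eq_mul_one_div c] at hpv hmv hpw hmw
  set a := 1 / ℓv
  set b := 1 / ℓw
  rw [mul_assoc, one_div, inv_mul_le_iff₀ hc0] at hAa hBb
  rw [mul_assoc] at haA hbB
  set A := exp (-2 * |v - t₀|) * d₀ with hA
  set B := exp (-2 * |w - t₀|) * d₀ with hB
  have hA0 : 0 < A := pos_of_mul_pos_right (by linarith) hc0.le
  have hB0 : 0 < B := pos_of_mul_pos_right (by linarith) hc0.le
  have hd₀' : 0 < d₀ := pos_of_mul_pos_right (hA ▸ hA0) (exp_pos _).le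
  have hAd : A ≤ d₀ :=
    mul_le_of_le_one_left hd₀ (exp_le_one_iff.2 (by linarith [abs_nonneg (v - t₀)]))
  have hBd : B ≤ d₀ :=
    mul_le_of_le_one_left hd₀ (exp_le_one_iff.2 (by linarith [abs_nonneg (w - t₀)]))
  have hAB_low : A * B ≤ 27 * c ^ 4 * (a * b) := by
    calc A * B ≤ (c * a) * (c * b) := by gcongr
      _ = c ^ 2 * (a * b) := by ring
      _ ≤ 27 * c ^ 4 * (a * b) := by gcongr; linarith
  have hAB_upp : a * b ≤ 27 * c ^ 4 * (A * B) := by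
    calc a * b ≤ (c * A) * (c * B) := by gcongr
      _ = c ^ 2 * (A * B) := by ring
      _ ≤ 27 * c ^ 4 * (A * B) := by gcongr; linarith
  obtain ⟨R, hR, hABR, hlow, hupp⟩ : ∃ R > 0, A * B = exp (-(2 * (w - v))) * R ^ 2 ∧
      R ^ 2 ≤ 27 * c ^ 4 * ((sv - sw) ^ 2 + a ^ 2 + b ^ 2) ∧
      (sv - sw) ^ 2 + a ^ 2 + b ^ 2 ≤ 27 * c ^ 4 * R ^ 2 := by
    have hle : exp (-(2 * (w - v))) ≤ 1 := exp_le_one_iff.2 (by linarith)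
    rcases le_total t₀ v with hv | hv
    · have hBA : B = exp (-(2 * (w - v))) * A := by
        rw [hA, hB, abs_of_nonneg (by linarith), abs_of_nonneg (by linarith), ← mul_assoc,
          ← exp_add]
        ring_nf
      refine ⟨A, hA0, by rw [hBA]; ring, sq_bounds_of_displacement_le hc ha (by linarith) hAa haA
        hbB (hBA ▸ mul_le_of_le_one_left hA0.le hle) hA0.le ?_⟩
      have h₁ := hpv hv
      have h₂ := hpw (hv.trans hvw)
      rw [abs_le] at *
      constructor <;> linarith
    rcases le_total w t₀ with hw | hw
    · have hAB : A = exp (-(2 * (w - v))) * B := by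
        rw [hA, hB, abs_of_nonpos (by linarith), abs_of_nonpos (by linarith), ← mul_assoc,
          ← exp_add]
        ring_nf
      have key := sq_bounds_of_displacement_le (s := sv - sw) hc hb (by linarith) hBb hbB
        haA (hAB ▸ mul_le_of_le_one_left hB0.le hle) hB0.le (by
          have h₁ := hmv hv
          have h₂ := hmw hw
          rw [abs_le] at *
          constructor <;> linarith)
      rw [add_right_comm] at key
      exact ⟨B, hB0, by rw [hAB]; ring, key⟩
    · refine ⟨d₀, hd₀', ?_, sq_bounds_of_displacement_near hc ha (by linarith) hd₀
        (haA.trans (by gcongr)) (hbB.trans (by gcongr)) ?_⟩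
      · rw [hA, hB, abs_of_nonpos (by linarith), abs_of_nonneg (by linarith),
          mul_mul_mul_comm, ← exp_add]
        ring_nf
      · have h₁ := hmv hv
        have h₂ := hpw hw
        have h₃ : |(|sv - sw| - |pv - mv|)| ≤ c + c * a + c * b := by
          refine (abs_abs_sub_abs_le_abs_sub _ _).trans ?_
          rw [abs_le] at hp h₁ h₂ ⊢
          constructor <;> linarith
        rw [abs_le] at hpmv h₃ ⊢
        constructor <;> linarith
  rw [hABR] at hAB_low hAB_upp
  rw [← hzv_im, ← hzw_im] at hAB_low hAB_upp hlow hupp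
  rw [← hzv_re, ← hzw_re] at hlow hupp
  exact abs_dist_sub_le_of_comparable hK hR hlow hupp hAB_low hAB_upp
end
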